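/- Let f be a computable function of two string arguments. There exists a constant d (depending only on f and the universal machine) such that for every nondeterministic communication protocol Π = (𝓡, t) over D = {0,1}^{n₁} × {0,1}^{n₂} that computes f, and every (x,y) ∈ D: C(t_{x,y} ∣ Π) ≥ C(f_{x,y} ∣ x, Π) + C(f_{x,y} ∣ y, Π) + C(t_{x,y} ∣ x, f_{x,y}, Π) + C(t_{x,y} ∣ y, f_{x,y}, Π) − log₂ ρ(t_{x,y}) − d·log₂ n − d, where n = max(n₁, n₂). -/

import Mathlib

/-- A machine maps a program and a condition string to at most one output string. -/
abbrev Machine := List Bool → List Bool →. List Bool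

/-- Conditional Kolmogorov complexity relative to machine `U`. -/
noncomputable def KC (U : Machine) (x u : List Bool) : ℕ :=
  sInf { k | ∃ p : List Bool, p.length = k ∧ x ∈ U p u }

/-- `U` is a universal machine. -/
def IsUniversal (U : Machine) : Prop :=
  Partrec₂ U ∧
    ∀ V : Machine, Partrec₂ V →
      ∃ c : ℕ, ∀ p u x, x ∈ V p u → ∃ q : List Bool, x ∈ U q u ∧ q.length ≤ p.length + c

/-- Self-delimiting encoding of a string. -/
def eBits (x : List Bool) : List Bool := (x.map fun b => [b, b]).flatten ++ [true, false]

/-- The fixed computable pairing of strings. -/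
def ePair (x y : List Bool) : List Bool := eBits x ++ y

/-- Encoding of a list of strings. -/
def eList (l : List (List Bool)) : List Bool := (l.map eBits).flatten

/-- Conditional mutual information `I(x : y ∣ u)`. -/
noncomputable def MI (U : Machine) (x y u : List Bool) : ℝ :=
  (KC U x u : ℝ) + KC U y u - KC U (ePair x y) u

/-- Conditional triple information `I(x : y : w ∣ u)`. -/
noncomputable def TI (U : Machine) (x y w u : List Bool) : ℝ :=
  (KC U x u : ℝ) + KC U y u + KC U w u - KC U (ePair x y) u - KC U (ePair x w) u
    - KC U (ePair y w) u + KC U (ePair x (ePair y w)) u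

/-- A combinatorial rectangle, given by its list of rows and list of columns. -/
structure Rect where
  rows : List (List Bool)
  cols : List (List Bool)
deriving DecidableEq

/-- Canonical encoding of a rectangle. -/
def encRect (R : Rect) : List Bool := ePair (eList R.rows) (eList R.cols)

/-- The list of all bit strings of length `n`. -/
def allBV : ℕ → List (List Bool)
  | 0 => [[]]
  | n + 1 => (allBV n).flatMap fun x => [false :: x, true :: x]

/-- A nondeterministic communication protocol over `{0,1}^{n₁} × {0,1}^{n₂}`:
a finite family of rectangles covering the domain together with a transcript
function selecting, for every cell of the domain, a rectangle containing it. -/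
structure Protocol (n₁ n₂ : ℕ) where
  rects : List Rect
  trans : List Bool → List Bool → Rect
  rows_len : ∀ R ∈ rects, ∀ s ∈ R.rows, s.length = n₁
  cols_len : ∀ R ∈ rects, ∀ s ∈ R.cols, s.length = n₂
  trans_mem : ∀ x y : List Bool, x.length = n₁ → y.length = n₂ → trans x y ∈ rects
  trans_row : ∀ x y : List Bool, x.length = n₁ → y.length = n₂ → x ∈ (trans x y).rows
  trans_col : ∀ x y : List Bool, x.length = n₁ → y.length = n₂ → y ∈ (trans x y).cols

/-- The thickness of a cell: the number of rectangles of the protocol containing it. -/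
def cellThick {n₁ n₂ : ℕ} (P : Protocol n₁ n₂) (x y : List Bool) : ℕ :=
  P.rects.countP fun R => decide (x ∈ R.rows ∧ y ∈ R.cols)

/-- The thickness of a rectangle: the maximal thickness of a cell of the rectangle. -/
def rectThick {n₁ n₂ : ℕ} (P : Protocol n₁ n₂) (R : Rect) : ℕ :=
  (R.rows.flatMap fun x => R.cols.map fun y => cellThick P x y).foldr max 0

/-- Canonical encoding of a protocol: the list of its rectangles followed by
the graph of the transcript function on the domain. -/
def encProt {n₁ n₂ : ℕ} (P : Protocol n₁ n₂) : List Bool :=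
  ePair (eList (P.rects.map encRect))
    (eList ((allBV n₁).flatMap fun x => (allBV n₂).map fun y => encRect (P.trans x y)))

/-- The protocol computes `f`: every rectangle of the protocol is `f`-monochromatic. -/
def Computes {n₁ n₂ : ℕ} (P : Protocol n₁ n₂) (f : List Bool → List Bool → List Bool) : Prop :=
  ∀ R ∈ P.rects, ∀ x y x' y' : List Bool,
    x ∈ R.rows → y ∈ R.cols → x' ∈ R.rows → y' ∈ R.cols → f x y = f x' y'

attribute [fun_prop] Primrec

@[fun_prop]
theorem primrec_id {α : Type*} [Primcodable α] : Primrec fun a : α => a := Primrec.id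

@[fun_prop]
theorem primrec_const {α β : Type*} [Primcodable α] [Primcodable β] (b : β) :
    Primrec fun _ : α => b := Primrec.const b

@[fun_prop]
theorem primrec_comp {α β γ : Type*} [Primcodable α] [Primcodable β] [Primcodable γ]
    {f : β → γ} {g : α → β} (hf : Primrec f) (hg : Primrec g) : Primrec fun a => f (g a) :=
  hf.comp hg

@[fun_prop]
theorem primrec_fst {α β γ : Type*} [Primcodable α] [Primcodable β] [Primcodable γ]
    {f : α → β × γ} (hf : Primrec f) : Primrec fun a => (f a).1 := Primrec.fst.comp hf

@[fun_prop]
theorem primrec_snd {α β γ : Type*} [Primcodable α] [Primcodable β] [Primcodable γ]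
    {f : α → β × γ} (hf : Primrec f) : Primrec fun a => (f a).2 := Primrec.snd.comp hf

@[fun_prop]
theorem primrec_mk {α β γ : Type*} [Primcodable α] [Primcodable β] [Primcodable γ]
    {f : α → β} {g : α → γ} (hf : Primrec f) (hg : Primrec g) : Primrec fun a => (f a, g a) :=
  hf.pair hg

/-- Semidecidable relations, presented by an increasing sequence of primitive recursive stages. -/
def SemiDec {α : Type*} [Primcodable α] (R : α → Prop) : Prop :=
  ∃ S : α → ℕ → Prop, PrimrecRel S ∧ (∀ a s t, s ≤ t → S a s → S a t) ∧ ∀ a, R a ↔ ∃ s, S a s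

namespace SemiDec

variable {α β γ : Type*} [Primcodable α] [Primcodable β] [Primcodable γ]

theorem of_iff {R R' : α → Prop} (h : SemiDec R) (e : ∀ a, R' a ↔ R a) : SemiDec R' := by
  rwa [show R' = R from funext fun a => propext (e a)]

theorem of_primrec {R : α → Prop} (h : PrimrecPred R) : SemiDec R :=
  ⟨fun a _ => R a, h.comp Primrec.fst, fun _ _ _ _ h => h, fun a => by simp⟩

theorem eq {f g : α → β} (hf : Primrec f) (hg : Primrec g) : SemiDec fun a => f a = g a :=
  of_primrec (Primrec.eq.comp hf hg)

theorem le {f g : α → ℕ} (hf : Primrec f) (hg : Primrec g) : SemiDec fun a => f a ≤ g a :=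
  of_primrec (Primrec.nat_le.comp hf hg)

theorem comp {R : β → Prop} (h : SemiDec R) {f : α → β} (hf : Primrec f) :
    SemiDec fun a => R (f a) := by
  obtain ⟨S, hS, hm, hR⟩ := h
  exact ⟨fun a s => S (f a) s, hS.comp (hf.comp Primrec.fst) Primrec.snd,
    fun a => hm (f a), fun a => hR (f a)⟩

theorem and {R R' : α → Prop} (h : SemiDec R) (h' : SemiDec R') :
    SemiDec fun a => R a ∧ R' a := by
  obtain ⟨S, hS, hm, hR⟩ := h
  obtain ⟨S', hS', hm', hR'⟩ := h'
  refine ⟨fun a s => S a s ∧ S' a s, PrimrecPred.and hS hS',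
    fun a s t hst h => ⟨hm a s t hst h.1, hm' a s t hst h.2⟩, fun a => ?_⟩
  constructor
  · rintro ⟨h, h'⟩
    obtain ⟨s, hs⟩ := (hR a).1 h
    obtain ⟨t, ht⟩ := (hR' a).1 h'
    exact ⟨max s t, hm a _ _ (le_max_left s t) hs, hm' a _ _ (le_max_right s t) ht⟩
  · rintro ⟨s, hs, hs'⟩
    exact ⟨(hR a).2 ⟨s, hs⟩, (hR' a).2 ⟨s, hs'⟩⟩

theorem primrecPred_decode {Q : α → β → Prop} (hQ : PrimrecRel Q) {e : α → ℕ} (he : Primrec e) :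
    PrimrecPred fun a => ∃ b, Encodable.decode (e a) = some b ∧ Q a b := by
  classical
  have h : Primrec fun a =>
      (Option.casesOn (Encodable.decode (e a) : Option β) false fun b => decide (Q a b) : Bool) :=
    Primrec.option_casesOn (Primrec.decode.comp he) (Primrec.const false) hQ.decide
  refine PrimrecPred.of_eq (p := fun a =>
    (Option.casesOn (Encodable.decode (e a) : Option β) false fun b => decide (Q a b) : Bool)
      = true) (Primrec.eq.comp h (Primrec.const true)) fun a => ?_
  cases (Encodable.decode (e a) : Option β) <;> simp

theorem ex {R : α → β → Prop} (h : SemiDec fun p : α × β => R p.1 p.2) :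
    SemiDec fun a => ∃ b, R a b := by
  obtain ⟨S, hS, hm, hR⟩ := h
  refine ⟨fun a s => ∃ e < s, ∃ b : β, Encodable.decode e = some b ∧ S (a, b) s, ?_, ?_, ?_⟩
  · have h1 : PrimrecRel fun (e : ℕ) (y : α × ℕ) =>
        ∃ b : β, Encodable.decode e = some b ∧ S (y.1, b) y.2 :=
      primrecPred_decode (α := ℕ × α × ℕ) (Q := fun y b => S (y.2.1, b) y.2.2)
        (hS.comp (f := fun p : (ℕ × α × ℕ) × β => (p.1.2.1, p.2)) (g := fun p => p.1.2.2)
          (by fun_prop) (by fun_prop)) Primrec.fst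
    have h2 : PrimrecRel fun (n : ℕ) (y : α × ℕ) => ∃ e < n,
        ∃ b : β, Encodable.decode e = some b ∧ S (y.1, b) y.2 :=
      (h1.exists_mem_list.comp (Primrec.list_range.comp Primrec.fst) Primrec.snd).of_eq (by simp)
    exact h2.comp (f := fun p : α × ℕ => p.2) (g := fun p => p) (by fun_prop) (by fun_prop)
  · rintro a s t hst ⟨e, he, b, hb, hs⟩
    exact ⟨e, he.trans_le hst, b, hb, hm _ _ _ hst hs⟩
  · intro a
    constructor
    · rintro ⟨b, hb⟩
      obtain ⟨s, hs⟩ := (hR (a, b)).1 hb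
      exact ⟨max s (Encodable.encode b + 1), Encodable.encode b, by omega, b, by simp,
        hm _ _ _ (le_max_left _ _) hs⟩
    · rintro ⟨s, e, -, b, -, hs⟩
      exact ⟨b, (hR (a, b)).2 ⟨s, hs⟩⟩

theorem forall_mem {R : α → β → Prop} (h : SemiDec fun p : α × β => R p.1 p.2)
    {l : α → List β} (hl : Primrec l) : SemiDec fun a => ∀ b ∈ l a, R a b := by
  obtain ⟨S, hS, hm, hR⟩ := h
  refine ⟨fun a s => ∀ b ∈ l a, S (a, b) s, ?_, ?_, ?_⟩
  · have h1 : PrimrecRel fun (b : β) (y : α × ℕ) => S (y.1, b) y.2 :=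
      hS.comp (f := fun p : β × α × ℕ => (p.2.1, p.1)) (g := fun p => p.2.2)
        (by fun_prop) (by fun_prop)
    exact h1.forall_mem_list.comp (f := fun p : α × ℕ => l p.1) (g := fun p => p)
      (by fun_prop) (by fun_prop)
  · exact fun a s t hst h b hb => hm _ _ _ hst (h b hb)
  · intro a
    constructor
    · intro H
      have H' : ∀ b, ∃ s, b ∈ l a → S (a, b) s := fun b => by
        by_cases hb : b ∈ l a
        · obtain ⟨s, hs⟩ := (hR (a, b)).1 (H b hb)
          exact ⟨s, fun _ => hs⟩
        · exact ⟨0, fun h => absurd h hb⟩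
      choose g hg using H'
      refine ⟨((l a).map g).foldr max 0, fun b hb => hm _ _ _ ?_ (hg b hb)⟩
      exact List.le_max_of_le' 0 (List.mem_map_of_mem hb) le_rfl
    · rintro ⟨s, hs⟩ b hb
      exact (hR (a, b)).2 ⟨s, hs b hb⟩

end SemiDec

theorem primrecRel_mem {α : Type*} [Primcodable α] :
    PrimrecRel fun (a : α) (l : List α) => a ∈ l :=
  (Primrec.eq.exists_mem_list.comp Primrec.snd Primrec.fst).of_eq (by simp)

theorem primrecPred_nodup {α : Type*} [Primcodable α] :
    PrimrecPred fun l : List α => l.Nodup := by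
  have h1 : PrimrecRel fun (i : ℕ) (y : ℕ × List α) => ¬ y.2[i]? = y.2[y.1]? :=
    (Primrec.eq.comp
      (Primrec.list_getElem?.comp (g := fun p : ℕ × ℕ × List α => p.2.2) (h := fun p => p.1)
        (by fun_prop) (by fun_prop))
      (Primrec.list_getElem?.comp (g := fun p : ℕ × ℕ × List α => p.2.2) (h := fun p => p.2.1)
        (by fun_prop) (by fun_prop))).not
  have h2 : PrimrecRel fun (j : ℕ) (l : List α) => ∀ i < j, ¬ l[i]? = l[j]? :=
    (h1.forall_mem_list.comp (f := fun p : ℕ × List α => List.range p.1) (g := fun p => p)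
      (Primrec.list_range.comp Primrec.fst) Primrec.id).of_eq (by simp)
  refine (h2.forall_mem_list.comp (f := fun l : List α => List.range l.length) (g := fun l => l)
    (Primrec.list_range.comp Primrec.list_length) Primrec.id).of_eq fun l => ?_
  rw [List.nodup_iff_getElem?_ne_getElem?]
  simp only [List.mem_range, ne_eq]
  exact ⟨fun h i j hij hj => h j hj i hij, fun h j hj i hij => h i j hij hj⟩

namespace SemiDec

variable {α β γ : Type*} [Primcodable α] [Primcodable β] [Primcodable γ]

theorem mem {f : α → β} {g : α → List β} (hf : Primrec f) (hg : Primrec g) :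
    SemiDec fun a => f a ∈ g a :=
  of_primrec (primrecRel_mem.comp hf hg)

theorem le_encard {R : α → β → Prop} (h : SemiDec fun p : α × β => R p.1 p.2)
    {k : α → ℕ} (hk : Primrec k) : SemiDec fun a => (k a : ℕ∞) ≤ {b | R a b}.encard := by
  have h1 : SemiDec fun a => ∃ l : List β, (l.Nodup ∧ k a ≤ l.length) ∧ ∀ b ∈ l, R a b := by
    refine ex (and (and ?_ ?_) ?_)
    · exact of_primrec (primrecPred_nodup.comp Primrec.snd)
    · exact le (by fun_prop) (Primrec.list_length.comp Primrec.snd)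
    · exact forall_mem (R := fun (p : α × List β) b => R p.1 b)
        (h.comp (f := fun p : (α × List β) × β => (p.1.1, p.2)) (by fun_prop)) Primrec.snd
  refine h1.of_iff fun a => ?_
  classical
  constructor
  · intro H
    obtain ⟨t, ht, htk⟩ := Set.exists_subset_encard_eq H
    have hfin : t.Finite := Set.finite_of_encard_eq_coe htk
    refine ⟨hfin.toFinset.toList, ⟨Finset.nodup_toList _, ?_⟩, fun b hb => ?_⟩
    · rw [hfin.encard_eq_coe_toFinset_card] at htk
      rw [Finset.length_toList]
      exact_mod_cast htk.ge
    · exact ht (by simpa using hb)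
  · rintro ⟨l, ⟨hl, hk⟩, hR⟩
    calc (k a : ℕ∞) ≤ (l.toFinset.card : ℕ∞) := by
          rw [List.toFinset_card_of_nodup hl]; exact_mod_cast hk
      _ = (l.toFinset : Set β).encard := (Set.encard_coe_eq_coe_finsetCard _).symm
      _ ≤ _ := Set.encard_le_encard fun b hb => hR b (by simpa using hb)

theorem of_partrec {f : α →. β} (hf : Partrec f) : SemiDec fun p : α × β => p.2 ∈ f p.1 := by
  obtain ⟨c, hc⟩ := Nat.Partrec.Code.exists_code.1 hf
  refine ⟨fun p s => Nat.Partrec.Code.evaln s c (Encodable.encode p.1) =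
    some (Encodable.encode p.2), ?_, ?_, ?_⟩
  · refine Primrec.eq.comp (Nat.Partrec.Code.primrec_evaln.comp
      (f := fun p : (ℕ × Nat.Partrec.Code) × ℕ => Nat.Partrec.Code.evaln p.1.1 p.1.2 p.2)
      (g := fun q : (α × β) × ℕ => ((q.2, c), Encodable.encode q.1.1)) ?_) ?_
    · exact .pair (by fun_prop) (Primrec.encode.comp (by fun_prop))
    · exact Primrec.option_some.comp (Primrec.encode.comp (by fun_prop))
  · exact fun p s t hst h => Nat.Partrec.Code.evaln_mono hst h
  · rintro ⟨a, b⟩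
    have := @Nat.Partrec.Code.evaln_complete c (Encodable.encode a) (Encodable.encode b)
    simp only [Option.mem_def] at this
    rw [← this, hc]
    simp

/-- Uniformization of a functional semidecidable relation by a partial recursive function. -/
theorem exists_partrec {R : α → β → Prop} (h : SemiDec fun p : α × β => R p.1 p.2)
    (hfun : ∀ a b b', R a b → R a b' → b = b') :
    ∃ f : α →. β, Partrec f ∧ ∀ a b, R a b → b ∈ f a := by
  classical
  obtain ⟨S, hS, hm, hR⟩ := h
  let g : α → ℕ → Option β := fun a n =>
    Option.casesOn (Encodable.decode n : Option (β × ℕ)) none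
      fun p => if S (a, p.1) p.2 then some p.1 else none
  have hg : Primrec₂ g := by
    refine Primrec.option_casesOn (Primrec.decode.comp Primrec.snd) (Primrec.const none)
      (Primrec.ite ?_ ?_ (Primrec.const none))
    · exact hS.comp (f := fun q : (α × ℕ) × β × ℕ => (q.1.1, q.2.1)) (g := fun q => q.2.2)
        (by fun_prop) (by fun_prop)
    · exact Primrec.option_some.comp (by fun_prop)
  have hgR : ∀ a n b, b ∈ g a n → R a b := by
    intro a n b hb
    dsimp only [g] at hb
    cases hd : (Encodable.decode n : Option (β × ℕ)) with
    | none => simp [hd] at hb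
    | some p =>
      rw [hd] at hb
      dsimp only at hb
      split_ifs at hb with h
      · obtain rfl : p.1 = b := by simpa using hb
        exact (hR (a, p.1)).2 ⟨_, h⟩
      · simp at hb
  refine ⟨fun a => Nat.rfindOpt (g a), Partrec.rfindOpt hg.to_comp, fun a b hab => ?_⟩
  obtain ⟨s, hs⟩ := (hR (a, b)).1 hab
  have hd : (Nat.rfindOpt (g a)).Dom :=
    Nat.rfindOpt_dom.2 ⟨Encodable.encode (b, s), b, by simp [g, hs]⟩
  obtain ⟨n, hn⟩ := Nat.rfindOpt_spec ⟨hd, rfl⟩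
  rw [hfun a b _ hab (hgR a n _ hn)]
  exact ⟨hd, rfl⟩

/-- Elements of a semidecidable set can be addressed by their rank in an enumeration. -/
theorem exists_index {R : α → β → Prop} (h : SemiDec fun p : α × β => R p.1 p.2) :
    ∃ I : α × ℕ → β → Prop, SemiDec (fun p : (α × ℕ) × β => I p.1 p.2) ∧
      (∀ a b b', I a b → I a b' → b = b') ∧
      ∀ a b (k : ℕ), R a b → {b | R a b}.encard ≤ k → ∃ i < k, I (a, i) b := by
  classical
  obtain ⟨S, hS, hm, hR⟩ := h
  let step : α → ℕ × List β → List β := fun a q =>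
    Option.casesOn (Encodable.decode q.1 : Option (β × ℕ)) q.2
      fun p => if S (a, p.1) p.2 ∧ ¬ p.1 ∈ q.2 then q.2 ++ [p.1] else q.2
  let L : α → ℕ → List β := fun a n => Nat.rec [] (fun n l => step a (n, l)) n
  have hL0 : ∀ a, L a 0 = [] := fun _ => rfl
  have hLs : ∀ a n, L a (n + 1) = step a (n, L a n) := fun _ _ => rfl
  have hstep : Primrec₂ step := by
    refine Primrec.option_casesOn (Primrec.decode.comp (by fun_prop)) (by fun_prop)
      (Primrec.ite (PrimrecPred.and ?_ (PrimrecPred.not ?_)) ?_ ?_)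
    · exact hS.comp (f := fun q : (α × ℕ × List β) × β × ℕ => (q.1.1, q.2.1))
        (g := fun q => q.2.2) (by fun_prop) (by fun_prop)
    · exact primrecRel_mem.comp (by fun_prop) (by fun_prop)
    · exact Primrec.list_concat.comp (by fun_prop) (by fun_prop)
    · fun_prop
  have hL : Primrec₂ L := Primrec.nat_rec (Primrec.const []) hstep
  have hstep_cases : ∀ a n l, step a (n, l) = l ∨
      ∃ b, R a b ∧ b ∉ l ∧ step a (n, l) = l ++ [b] := by
    intro a n l
    dsimp only [step]
    cases hd : (Encodable.decode n : Option (β × ℕ)) with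
    | none => exact Or.inl rfl
    | some p =>
      dsimp only
      split_ifs with h
      · exact Or.inr ⟨p.1, (hR (a, p.1)).2 ⟨_, h.1⟩, h.2, rfl⟩
      · exact Or.inl rfl
  have hstep_mem : ∀ a b s l, S (a, b) s → b ∈ step a (Encodable.encode (b, s), l) := by
    intro a b s l hs
    dsimp only [step]
    rw [Encodable.encodek]
    dsimp only
    split_ifs with h
    · simp
    · by_contra hb
      exact h ⟨hs, hb⟩
  have hpre1 : ∀ a n, L a n <+: L a (n + 1) := by
    intro a n
    rw [hLs]
    rcases hstep_cases a n (L a n) with h | ⟨b, -, -, h⟩ <;> rw [h]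
    exact List.prefix_append _ _
  have hpre : ∀ a n m, n ≤ m → L a n <+: L a m := by
    intro a n m hnm
    induction hnm with
    | refl => exact List.prefix_rfl
    | step _ ih => exact ih.trans (hpre1 a _)
  have hinv : ∀ a n, (L a n).Nodup ∧ ∀ b ∈ L a n, R a b := by
    intro a n
    induction n with
    | zero => simp [hL0]
    | succ n ih =>
      rw [hLs]
      rcases hstep_cases a n (L a n) with h | ⟨c, hc, hcl, h⟩ <;> rw [h]
      · exact ih
      · refine ⟨?_, fun b hb => ?_⟩
        · rw [List.nodup_append]
          refine ⟨ih.1, by simp, ?_⟩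
          rintro x hx y hy rfl
          rw [List.mem_singleton] at hy
          exact hcl (hy ▸ hx)
        · rcases List.mem_append.1 hb with hb | hb
          · exact ih.2 b hb
          · rwa [List.mem_singleton.1 hb]
  refine ⟨fun p b => ∃ n, (L p.1 n)[p.2]? = some b, ?_, ?_, ?_⟩
  · refine ex (eq (Primrec.list_getElem?.comp (hL.comp ?_ ?_) ?_) (Primrec.option_some.comp ?_))
    all_goals fun_prop
  · rintro ⟨a, i⟩ b b' ⟨n, hn⟩ ⟨m, hm'⟩
    have key : ∀ n m c, n ≤ m → (L a n)[i]? = some c → (L a m)[i]? = some c := by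
      intro n m c hnm hc
      obtain ⟨t, ht⟩ := hpre a n m hnm
      obtain ⟨hi, -⟩ := List.getElem?_eq_some_iff.1 hc
      rw [← ht, List.getElem?_append_left hi, hc]
    have h1 := key n (max n m) b (le_max_left _ _) hn
    have h2 := key m (max n m) b' (le_max_right _ _) hm'
    exact Option.some_injective _ (h1.symm.trans h2)
  · intro a b k hab hk
    obtain ⟨s, hs⟩ := (hR (a, b)).1 hab
    have hb : b ∈ L a (Encodable.encode (b, s) + 1) := by
      rw [hLs]
      exact hstep_mem a b s _ hs
    obtain ⟨i, hi, hib⟩ := List.mem_iff_getElem.1 hb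
    refine ⟨i, hi.trans_le ?_, Encodable.encode (b, s) + 1, List.getElem?_eq_some_iff.2 ⟨hi, hib⟩⟩
    have hinv' := hinv a (Encodable.encode (b, s) + 1)
    have : ((L a (Encodable.encode (b, s) + 1)).toFinset.card : ℕ∞) ≤ k := by
      rw [← Set.encard_coe_eq_coe_finsetCard]
      exact (Set.encard_le_encard fun c hc => hinv'.2 c (by simpa using hc)).trans hk
    rw [List.toFinset_card_of_nodup hinv'.1] at this
    exact_mod_cast this

end SemiDec

theorem ePair_nil (y : List Bool) : ePair [] y = true :: false :: y := rfl

theorem ePair_cons (b : Bool) (x y : List Bool) : ePair (b :: x) y = b :: b :: ePair x y := rfl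

theorem ePair_inj : ∀ {x x' y y' : List Bool}, ePair x y = ePair x' y' → x = x' ∧ y = y'
  | [], [], _, _, h => by simpa [ePair_nil] using h
  | [], b :: x', _, _, h => by
    rw [ePair_nil, ePair_cons] at h
    simp only [List.cons.injEq] at h
    rw [← h.1] at h
    simp at h
  | b :: x, [], _, _, h => by
    rw [ePair_nil, ePair_cons] at h
    simp only [List.cons.injEq] at h
    rw [h.1] at h
    simp at h
  | b :: x, b' :: x', _, _, h => by
    rw [ePair_cons, ePair_cons] at h
    simp only [List.cons.injEq] at h
    obtain ⟨h1, h2⟩ := ePair_inj h.2.2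
    exact ⟨by rw [h.1, h1], h2⟩

theorem eList_cons (a : List Bool) (l : List (List Bool)) : eList (a :: l) = ePair a (eList l) :=
  rfl

theorem ePair_ne_nil (x y : List Bool) : ePair x y ≠ [] := by
  cases x <;> simp [ePair_nil, ePair_cons]

theorem eList_inj : ∀ {l l' : List (List Bool)}, eList l = eList l' → l = l'
  | [], [], _ => rfl
  | [], a :: l', h => absurd h.symm (ePair_ne_nil a (eList l'))
  | a :: l, [], h => absurd h (ePair_ne_nil a (eList l))
  | a :: l, a' :: l', h => by
    obtain ⟨h1, h2⟩ := ePair_inj h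
    rw [h1, eList_inj h2]

theorem length_eBits (x : List Bool) : (eBits x).length = 2 * x.length + 2 := by
  induction x with
  | nil => rfl
  | cons b x ih =>
    have : eBits (b :: x) = b :: b :: eBits x := rfl
    rw [this]
    simp only [List.length_cons, ih]
    ring

theorem length_ePair (x y : List Bool) : (ePair x y).length = 2 * x.length + 2 + y.length := by
  rw [ePair, List.length_append, length_eBits]

theorem length_eList_le {N : ℕ} : ∀ {l : List (List Bool)}, (∀ a ∈ l, a.length ≤ N) →
    (eList l).length ≤ l.length * (2 * N + 2)
  | [], _ => by simp [eList]
  | a :: l, h => by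
    have h1 := length_eList_le (l := l) fun b hb => h b (List.mem_cons_of_mem _ hb)
    have h2 := h a List.mem_cons_self
    rw [eList_cons, length_ePair, List.length_cons]
    nlinarith

@[fun_prop]
theorem primrec_eBits {α : Type*} [Primcodable α] {f : α → List Bool} (hf : Primrec f) :
    Primrec fun a => eBits (f a) := by
  have h : Primrec eBits :=
    Primrec.list_append.comp (Primrec.list_flatten.comp (Primrec.list_map Primrec.id
      (Primrec.list_cons.comp Primrec.snd
        (Primrec.list_cons.comp Primrec.snd (Primrec.const []))))) (Primrec.const [true, false])
  exact h.comp hf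

@[fun_prop]
theorem primrec_ePair {α : Type*} [Primcodable α] {f g : α → List Bool} (hf : Primrec f)
    (hg : Primrec g) : Primrec fun a => ePair (f a) (g a) :=
  Primrec.list_append.comp (primrec_eBits hf) hg

@[fun_prop]
theorem primrec_eList {α : Type*} [Primcodable α] {f : α → List (List Bool)} (hf : Primrec f) :
    Primrec fun a => eList (f a) :=
  Primrec.list_flatten.comp (Primrec.list_map hf (primrec_eBits Primrec.snd))

/-- The natural number with given binary digits, least significant digit first. -/
def ofBits (l : List Bool) : ℕ := l.foldr (fun b n => (if b = true then 1 else 0) + 2 * n) 0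

theorem ofBits_bits (n : ℕ) : ofBits n.bits = n := by
  induction n using Nat.binaryRec' with
  | zero => simp [ofBits]
  | bit b n h ih =>
    rw [Nat.bits_append_bit n b h]
    change (if b = true then 1 else 0) + 2 * ofBits n.bits = _
    rw [ih, Nat.bit_val]
    cases b <;> simp; ring

@[fun_prop]
theorem primrec_ofBits {α : Type*} [Primcodable α] {f : α → List Bool} (hf : Primrec f) :
    Primrec fun a => ofBits (f a) := by
  have h : Primrec fun p : α × Bool × ℕ => (if p.2.1 = true then 1 else 0) + 2 * p.2.2 :=
    Primrec.nat_add.comp (Primrec.ite (Primrec.eq.comp (by fun_prop) (by fun_prop)) (by fun_prop)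
      (by fun_prop)) (Primrec.nat_mul.comp (by fun_prop) (by fun_prop))
  exact Primrec.list_foldr hf (Primrec.const 0) h.to₂

theorem KC_le {U : Machine} {p x u : List Bool} (h : x ∈ U p u) : KC U x u ≤ p.length :=
  Nat.sInf_le ⟨p, rfl, h⟩

theorem IsUniversal.KC_le_of_semiDec {U : Machine} (hU : IsUniversal U)
    {R : List Bool × List Bool → List Bool → Prop}
    (hR : SemiDec fun a : (List Bool × List Bool) × List Bool => R a.1 a.2)
    (hfun : ∀ a b b', R a b → R a b' → b = b') :
    ∃ c : ℕ, ∀ p u x, R (p, u) x → KC U x u ≤ p.length + c := by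
  obtain ⟨g, hg, hgR⟩ := hR.exists_partrec hfun
  obtain ⟨c, hc⟩ := hU.2 (fun p u => g (p, u)) hg
  refine ⟨c, fun p u x h => ?_⟩
  obtain ⟨q, hq, hql⟩ := hc p u x (hgR _ _ h)
  exact (KC_le hq).trans hql

theorem IsUniversal.exists_program {U : Machine} (hU : IsUniversal U) (x u : List Bool) :
    ∃ p : List Bool, p.length = KC U x u ∧ x ∈ U p u := by
  obtain ⟨c, hc⟩ := hU.2 (fun p _ => Part.some p) Computable.fst
  obtain ⟨q, hq, -⟩ := hc x u x (Part.mem_some x)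
  exact Nat.sInf_mem (s := { k | ∃ p : List Bool, p.length = k ∧ x ∈ U p u }) ⟨_, q, rfl, hq⟩

theorem IsUniversal.KC_le_length {U : Machine} (hU : IsUniversal U) :
    ∃ c : ℕ, ∀ x u, KC U x u ≤ x.length + c := by
  obtain ⟨c, hc⟩ := hU.KC_le_of_semiDec (R := fun a b => a.1 = b)
    (SemiDec.eq (by fun_prop) (by fun_prop)) (fun a b b' h h' => h.symm.trans h')
  exact ⟨c, fun x u => hc x u x rfl⟩

/-- An element of a semidecidable set of at most `2 ^ k` elements can be described by `k` bits,
up to the cost of specifying the numerical parameters of the set. -/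
theorem IsUniversal.KC_le_of_encard_le {U : Machine} (hU : IsUniversal U)
    {R : List ℕ × List Bool → List Bool → Prop}
    (hR : SemiDec fun a : (List ℕ × List Bool) × List Bool => R a.1 a.2) :
    ∃ c : ℕ, ∀ q u x (k M : ℕ), R (q, u) x → {z | R (q, u) z}.encard ≤ (2 ^ k : ℕ) →
      (∀ a ∈ q, a ≤ M) → KC U x u ≤ k + q.length * (4 * M.size + 4) + c := by
  obtain ⟨I, hI, hIfun, hIR⟩ := hR.exists_index
  obtain ⟨c, hc⟩ := hU.KC_le_of_semiDec
    (R := fun a z => ∃ v : List (List Bool) × List Bool, a.1 = ePair (eList v.1) v.2 ∧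
      I ((v.1.map ofBits, a.2), ofBits v.2) z)
    (SemiDec.ex (SemiDec.and (SemiDec.eq (by fun_prop) (by fun_prop))
      (hI.comp (f := fun p : ((List Bool × List Bool) × List Bool) × List (List Bool) × List Bool =>
        (((p.2.1.map ofBits, p.1.1.2), ofBits p.2.2), p.1.2))
        (.pair (.pair (.pair (Primrec.list_map (by fun_prop) (primrec_ofBits Primrec.snd))
          (by fun_prop)) (by fun_prop)) (by fun_prop)))))
    (by
      rintro ⟨p, u⟩ z z' ⟨⟨l, b⟩, h, hz⟩ ⟨⟨l', b'⟩, h', hz'⟩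
      obtain ⟨h1, rfl⟩ := ePair_inj (h.symm.trans h')
      obtain rfl := eList_inj h1
      exact hIfun _ _ _ hz hz')
  refine ⟨c + 2, fun q u x k M hx hk hM => ?_⟩
  obtain ⟨i, hi, hix⟩ := hIR (q, u) x (2 ^ k) hx hk
  have key := hc (ePair (eList (q.map Nat.bits)) i.bits) u x
    ⟨(q.map Nat.bits, i.bits), rfl, by
      simpa [List.map_map, Function.comp_def, ofBits_bits] using hix⟩
  have h1 : i.bits.length ≤ k := by
    rw [Nat.size_eq_bits_len]
    exact Nat.size_le.2 hi
  have h2 : (eList (q.map Nat.bits)).length ≤ q.length * (2 * M.size + 2) := by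
    have := length_eList_le (N := M.size) (l := q.map Nat.bits) (by
      intro a ha
      obtain ⟨b, hb, rfl⟩ := List.mem_map.1 ha
      rw [Nat.size_eq_bits_len]
      exact Nat.size_le_size (hM b hb))
    simpa using this
  rw [length_ePair] at key
  calc KC U x u ≤ _ := key
    _ ≤ 2 * (q.length * (2 * M.size + 2)) + 2 + k + c := by gcongr
    _ = _ := by ring

@[fun_prop]
theorem primrec_getD {α : Type*} [Primcodable α] {f : α → List ℕ} (hf : Primrec f) (i : ℕ) :
    Primrec fun a => (f a).getD i 0 :=
  (Primrec.list_getD 0).comp hf (Primrec.const i)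

@[fun_prop]
theorem primrec_two_pow {α : Type*} [Primcodable α] {f : α → ℕ} (hf : Primrec f) :
    Primrec fun a => 2 ^ f a := by
  refine (Primrec.nat_rec' hf (Primrec.const 1)
    (h := fun _ p => 2 * p.2) (Primrec.nat_mul.comp (Primrec.const 2) (by fun_prop))).of_eq
    fun a => ?_
  induction f a with
  | zero => rfl
  | succ n ih => rw [pow_succ, ← ih, mul_comm]

theorem encard_mul_le_encard_mul {α β : Type*} (r : α → β → Prop) {s : Set α} {t : Set β}
    (ht : t.Finite) (m n : ℕ) (hm : ∀ a ∈ s, (m : ℕ∞) ≤ {b | b ∈ t ∧ r a b}.encard)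
    (hn : ∀ b ∈ t, {a | a ∈ s ∧ r a b}.encard ≤ n) : s.encard * m ≤ t.encard * n := by
  classical
  have key : ∀ F : Finset α, (F : Set α) ⊆ s → F.card * m ≤ ht.toFinset.card * n := by
    intro F hF
    refine Finset.card_mul_le_card_mul r (fun a ha => ?_) fun b hb => ?_
    · have h := hm a (hF ha)
      rw [show {b | b ∈ t ∧ r a b} = (ht.toFinset.bipartiteAbove r a : Set β) by
        ext b; simp [Finset.bipartiteAbove], Set.encard_coe_eq_coe_finsetCard] at h
      exact_mod_cast h
    · have h : ((F.bipartiteBelow r b : Finset α) : Set α).encard ≤ n :=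
        (Set.encard_le_encard fun a ha => by
          have := Finset.mem_coe.1 ha
          rw [Finset.bipartiteBelow, Finset.mem_filter] at this
          exact ⟨hF this.1, this.2⟩).trans (hn b (by simpa using hb))
      rw [Set.encard_coe_eq_coe_finsetCard] at h
      exact_mod_cast h
  rw [ht.encard_eq_coe_toFinset_card]
  by_cases hs : s.Finite
  · rw [hs.encard_eq_coe_toFinset_card]
    exact_mod_cast key hs.toFinset (by simp)
  · rcases Nat.eq_zero_or_pos m with rfl | hm0
    · simp
    · obtain ⟨F, hF, hFc⟩ := Set.Infinite.exists_subset_card_eq hs (ht.toFinset.card * n + 1)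
      have := key F hF
      rw [hFc] at this
      nlinarith

theorem exists_two_pow_le_encard {α : Type*} {s : Set α} (hs : s.Finite) (hne : s.Nonempty) :
    ∃ i : ℕ, ((2 ^ i : ℕ) : ℕ∞) ≤ s.encard ∧ s.encard ≤ (2 ^ (i + 1) : ℕ) := by
  have h0 : s.ncard ≠ 0 := by
    rw [Ne, Set.ncard_eq_zero hs]
    exact hne.ne_empty
  refine ⟨Nat.log 2 s.ncard, ?_, ?_⟩ <;> rw [← hs.cast_ncard_eq]
  · exact_mod_cast Nat.pow_log_le_self 2 h0
  · exact_mod_cast (Nat.lt_pow_succ_log_self one_lt_two _).le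

theorem le_of_two_pow_le_encard {α : Type*} {s : Set α} {i k : ℕ}
    (h : ((2 ^ i : ℕ) : ℕ∞) ≤ s.encard) (h' : s.encard ≤ (2 ^ k : ℕ)) : i ≤ k :=
  (Nat.pow_le_pow_iff_right one_lt_two).1 (by exact_mod_cast h.trans h')

/-- `Describable U m x u` holds when `x` has a program of length at most `m` given `u`. -/
def Describable (U : Machine) (m : ℕ) (x u : List Bool) : Prop :=
  ∃ p : List Bool, p.length ≤ m ∧ x ∈ U p u

theorem IsUniversal.describable {U : Machine} (hU : IsUniversal U) (x u : List Bool) :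
    Describable U (KC U x u) x u := by
  obtain ⟨p, hp, hx⟩ := hU.exists_program x u
  exact ⟨p, hp.le, hx⟩

theorem encard_length_le (m : ℕ) :
    {p : List Bool | p.length ≤ m}.encard + 1 ≤ (2 ^ (m + 1) : ℕ) := by
  induction m with
  | zero =>
    rw [show {p : List Bool | p.length ≤ 0} = {[]} by ext p; simp]
    norm_num
  | succ m ih =>
    have hsub : {p : List Bool | p.length ≤ m + 1} ⊆
        {[]} ∪ (List.cons true '' {p | p.length ≤ m} ∪
          List.cons false '' {p | p.length ≤ m}) := by
      rintro (_ | ⟨b, p⟩) hp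
      · simp
      · have : p.length ≤ m := by simpa using hp
        cases b <;> simp [this]
    have hle : ∀ b, (List.cons b '' {p : List Bool | p.length ≤ m}).encard ≤
        {p : List Bool | p.length ≤ m}.encard := fun b => Set.encard_image_le _ _
    calc {p : List Bool | p.length ≤ m + 1}.encard + 1
        ≤ (1 + ({p : List Bool | p.length ≤ m}.encard + {p : List Bool | p.length ≤ m}.encard))
            + 1 := by
          gcongr
          refine (Set.encard_le_encard hsub).trans ((Set.encard_union_le _ _).trans ?_)
          rw [Set.encard_singleton]
          gcongr
          exact (Set.encard_union_le _ _).trans (add_le_add (hle _) (hle _))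
      _ = ({p : List Bool | p.length ≤ m}.encard + 1) +
            ({p : List Bool | p.length ≤ m}.encard + 1) := by ring
      _ ≤ (2 ^ (m + 1) : ℕ) + (2 ^ (m + 1) : ℕ) := add_le_add ih ih
      _ = (2 ^ (m + 1 + 1) : ℕ) := by rw [pow_succ 2 (m + 1), mul_two]; push_cast; rfl

theorem encard_describable_le (U : Machine) (m : ℕ) (u : List Bool) :
    {x | Describable U m x u}.encard ≤ (2 ^ (m + 1) : ℕ) := by
  classical
  have h : ∀ x, ∃ p : List Bool, Describable U m x u → p.length ≤ m ∧ x ∈ U p u := fun x => by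
    by_cases hx : Describable U m x u
    · obtain ⟨p, hp⟩ := hx
      exact ⟨p, fun _ => hp⟩
    · exact ⟨[], fun h => absurd h hx⟩
  choose g hg using h
  refine (Set.encard_le_encard_of_injOn (t := {p : List Bool | p.length ≤ m}) (f := g)
    (fun x hx => (hg x hx).1) fun x hx x' hx' he => ?_).trans
    (le_self_add.trans (encard_length_le m))
  have h1 := (hg x hx).2
  rw [he] at h1
  exact Part.mem_unique h1 (hg x' hx').2

theorem finite_describable (U : Machine) (m : ℕ) (u : List Bool) :
    {x | Describable U m x u}.Finite :=
  Set.finite_of_encard_le_coe (encard_describable_le U m u)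

section Relations

variable {α : Type*} [Primcodable α]

theorem IsUniversal.semiDec_describable {U : Machine} (hU : IsUniversal U) {m : α → ℕ}
    {x u : α → List Bool} (hm : Primrec m) (hx : Primrec x) (hu : Primrec u) :
    SemiDec fun v => Describable U (m v) (x v) (u v) := by
  refine SemiDec.ex (SemiDec.and (SemiDec.le (Primrec.list_length.comp (by fun_prop))
    (by fun_prop)) ?_)
  exact (SemiDec.of_partrec hU.1).comp
    (f := fun p : α × List Bool => ((p.2, u p.1), x p.1)) (by fun_prop)

/-- `x` occurs in the list encoded by the first component of `r`. -/
def InFst (r x : List Bool) : Prop :=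
  ∃ q : List (List Bool) × List Bool, r = ePair (eList q.1) q.2 ∧ x ∈ q.1

/-- `x` occurs in the list encoded by the second component of `r`. -/
def InSnd (r x : List Bool) : Prop :=
  ∃ q : List Bool × List (List Bool), r = ePair q.1 (eList q.2) ∧ x ∈ q.2

theorem inFst_ePair {l : List (List Bool)} {v x : List Bool} :
    InFst (ePair (eList l) v) x ↔ x ∈ l := by
  constructor
  · rintro ⟨q, h, hx⟩
    rwa [eList_inj (ePair_inj h).1]
  · exact fun h => ⟨(l, v), rfl, h⟩

theorem inSnd_ePair {l : List (List Bool)} {v x : List Bool} :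
    InSnd (ePair v (eList l)) x ↔ x ∈ l := by
  constructor
  · rintro ⟨q, h, hx⟩
    rwa [eList_inj (ePair_inj h).2]
  · exact fun h => ⟨(v, l), rfl, h⟩

theorem semiDec_inFst {r x : α → List Bool} (hr : Primrec r) (hx : Primrec x) :
    SemiDec fun v => InFst (r v) (x v) :=
  SemiDec.ex (SemiDec.and (SemiDec.eq (by fun_prop) (by fun_prop))
    (SemiDec.mem (by fun_prop) (by fun_prop)))

theorem semiDec_inSnd {r x : α → List Bool} (hr : Primrec r) (hx : Primrec x) :
    SemiDec fun v => InSnd (r v) (x v) :=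
  SemiDec.ex (SemiDec.and (SemiDec.eq (by fun_prop) (by fun_prop))
    (SemiDec.mem (by fun_prop) (by fun_prop)))

/-- `z` is a value of `f` on the rectangle encoded by `t`. -/
def ValueOn (f : List Bool → List Bool → List Bool) (t z : List Bool) : Prop :=
  ∃ q : List Bool × List Bool, (InFst t q.1 ∧ InSnd t q.2) ∧ z ∈ Part.some (f q.1 q.2)

theorem semiDec_valueOn {f : List Bool → List Bool → List Bool} (hf : Computable₂ f)
    {t z : α → List Bool} (ht : Primrec t) (hz : Primrec z) :
    SemiDec fun v => ValueOn f (t v) (z v) := by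
  refine SemiDec.ex (SemiDec.and (SemiDec.and (semiDec_inFst (by fun_prop) (by fun_prop))
    (semiDec_inSnd (by fun_prop) (by fun_prop))) ?_)
  exact (SemiDec.of_partrec (Computable.partrec hf)).comp
    (f := fun p : α × List Bool × List Bool => (p.2, z p.1)) (by fun_prop)

/-- The pairs of a string `x` and a rectangle `t` of the protocol `u`, with `x` on the side `S`
of `t`, such that `t` has complexity at most `m` and `x` has complexity at most `a` given `t`. -/
def Edge (U : Machine) (S : List Bool → List Bool → Prop) (m a : ℕ) (u x t : List Bool) : Prop :=
  ((InFst u t ∧ S t x) ∧ Describable U m t u) ∧ Describable U a x (ePair t u)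

/-- The string `x` has at least `2 ^ i` edges. -/
def Rich (U : Machine) (S : List Bool → List Bool → Prop) (m a i : ℕ) (u x : List Bool) : Prop :=
  ((2 ^ i : ℕ) : ℕ∞) ≤ {t | Edge U S m a u x t}.encard

theorem IsUniversal.semiDec_edge {U : Machine} (hU : IsUniversal U)
    {S : List Bool → List Bool → Prop} (hS : SemiDec fun p : List Bool × List Bool => S p.1 p.2)
    {m a : α → ℕ} {u x t : α → List Bool} (hm : Primrec m) (ha : Primrec a) (hu : Primrec u)
    (hx : Primrec x) (ht : Primrec t) :
    SemiDec fun v => Edge U S (m v) (a v) (u v) (x v) (t v) :=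
  SemiDec.and (SemiDec.and (SemiDec.and (semiDec_inFst hu ht)
    (hS.comp (f := fun v => (t v, x v)) (by fun_prop))) (hU.semiDec_describable hm ht hu))
    (hU.semiDec_describable ha hx (by fun_prop))

theorem IsUniversal.semiDec_rich {U : Machine} (hU : IsUniversal U)
    {S : List Bool → List Bool → Prop} (hS : SemiDec fun p : List Bool × List Bool => S p.1 p.2)
    {m a i : α → ℕ} {u x : α → List Bool} (hm : Primrec m) (ha : Primrec a) (hi : Primrec i)
    (hu : Primrec u) (hx : Primrec x) :
    SemiDec fun v => Rich U S (m v) (a v) (i v) (u v) (x v) :=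
  SemiDec.le_encard (R := fun v t => Edge U S (m v) (a v) (u v) (x v) t)
    (hU.semiDec_edge hS (by fun_prop) (by fun_prop) (by fun_prop) (by fun_prop) (by fun_prop))
    (primrec_two_pow hi)

/-- The encoding of the rectangle with given rows and columns. -/
def encSides (q : List (List Bool) × List (List Bool)) : List Bool :=
  ePair (eList q.1) (eList q.2)

/-- Every cell of the rectangle `t` lies in at most `N` different rectangles of the
protocol `u`. -/
def Thin (u t : List Bool) (N : ℕ) : Prop :=
  ∃ q : (List (List (List Bool) × List (List Bool)) × List Bool) ×
      List (List Bool) × List (List Bool),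
    (u = ePair (eList (q.1.1.map encSides)) q.1.2 ∧ t = encSides q.2) ∧
      ∀ x ∈ q.2.1, ∀ y ∈ q.2.2, ∃ M : List (List (List Bool) × List (List Bool)),
        M.length ≤ N ∧ ∀ R ∈ q.1.1, ¬ (x ∈ R.1 ∧ y ∈ R.2 ∧ ¬ R ∈ M)

theorem semiDec_thin {u t : α → List Bool} {N : α → ℕ} (hu : Primrec u) (ht : Primrec t)
    (hN : Primrec N) : SemiDec fun v => Thin (u v) (t v) (N v) := by
  refine SemiDec.ex (SemiDec.and (SemiDec.and (SemiDec.eq (by fun_prop) ?_)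
    (SemiDec.eq (by fun_prop) ?_)) ?_)
  · refine primrec_ePair (primrec_eList (Primrec.list_map (by fun_prop) ?_)) (by fun_prop)
    exact primrec_ePair (primrec_eList (Primrec.fst.comp Primrec.snd))
      (primrec_eList (Primrec.snd.comp Primrec.snd))
  · exact primrec_ePair (by fun_prop) (by fun_prop)
  · refine SemiDec.forall_mem ?_ (by fun_prop)
    refine SemiDec.forall_mem ?_ (by fun_prop)
    refine SemiDec.ex ?_
    refine SemiDec.and (SemiDec.le (Primrec.list_length.comp (by fun_prop)) (by fun_prop)) ?_
    refine SemiDec.forall_mem ?_ (by fun_prop)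
    refine SemiDec.of_primrec (PrimrecPred.not (PrimrecPred.and ?_ (PrimrecPred.and ?_
      (PrimrecPred.not ?_))))
    all_goals exact primrecRel_mem.comp (by fun_prop) (by fun_prop)

end Relations

section Bounds

theorem le_of_mul_two_pow_le {a b : ℕ∞} (l : ℕ) (h : a * (2 ^ l : ℕ) ≤ b * (2 ^ l : ℕ)) :
    a ≤ b := by
  rwa [ENat.mul_le_mul_right_iff (by simp) (ENat.natCast_ne_top _)] at h

theorem encard_edge_le (m a : ℕ) (u x : List Bool) :
    {t | Edge U S m a u x t}.encard ≤ (2 ^ (m + 1) : ℕ) :=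
  (Set.encard_le_encard fun _ ht => ht.1.2).trans (encard_describable_le U m u)

theorem encard_rich_mul_le (m a i : ℕ) (u : List Bool) :
    {x | Rich U S m a i u x}.encard * (2 ^ i : ℕ) ≤ (2 ^ (m + a + 2) : ℕ) := by
  have h := encard_mul_le_encard_mul (fun x t => Edge U S m a u x t)
    (s := {x | Rich U S m a i u x}) (finite_describable U m u) (2 ^ i) (2 ^ (a + 1))
    (fun x hx => hx.trans (Set.encard_le_encard fun t ht => ⟨ht.1.2, ht⟩))
    (fun t _ => (Set.encard_le_encard fun x hx => hx.2.2).trans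
      (encard_describable_le U a (ePair t u)))
  calc _ ≤ _ := h
    _ ≤ ((2 ^ (m + 1) : ℕ) : ℕ∞) * (2 ^ (a + 1) : ℕ) := by
      gcongr; exact encard_describable_le U m u
    _ = (2 ^ (m + a + 2) : ℕ) := by
      rw [← Nat.cast_mul, ← pow_add]; congr 2; ring

theorem encard_rich_le (m a i : ℕ) (u : List Bool) :
    {x | Rich U S m a i u x}.encard ≤ (2 ^ (m + a + 2) : ℕ) := by
  refine le_trans ?_ (encard_rich_mul_le (U := U) (S := S) m a i u)
  exact le_mul_of_one_le_right' (by exact_mod_cast Nat.one_le_two_pow)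

/-- The degree of `x` and the number of rich strings on the side `S` of the rectangle `t`. -/
theorem IsUniversal.exists_degree (hU : IsUniversal U)
    (hS : SemiDec fun p : List Bool × List Bool => S p.1 p.2) :
    ∃ c : ℕ, ∀ u t x m a, KC U x (ePair t u) = a → Edge U S m a u x t → ∃ i k : ℕ,
      Rich U S m a i u x ∧ {t | Edge U S m a u x t}.encard ≤ (2 ^ (i + 1) : ℕ) ∧
      i ≤ m + 1 ∧ k ≤ m + a + 2 ∧
      ((2 ^ k : ℕ) : ℕ∞) ≤ {x' | S t x' ∧ Rich U S m a i u x'}.encard ∧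
      ∀ M, m + 1 ≤ M → a ≤ M → a ≤ k + 1 + 3 * (4 * M.size + 4) + c := by
  obtain ⟨c, hc⟩ := hU.KC_le_of_encard_le
    (R := fun v x => ∃ p : List Bool × List Bool, v.2 = ePair p.1 p.2 ∧ S p.1 x ∧
      Rich U S (v.1.getD 0 0) (v.1.getD 1 0) (v.1.getD 2 0) p.2 x)
    (SemiDec.ex (SemiDec.and (SemiDec.eq (by fun_prop) (by fun_prop)) (SemiDec.and
      (hS.comp (f := fun v : ((List ℕ × List Bool) × List Bool) × List Bool × List Bool =>
        (v.2.1, v.1.2)) (by fun_prop))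
      (hU.semiDec_rich hS (by fun_prop) (by fun_prop) (by fun_prop) (by fun_prop)
        (by fun_prop)))))
  refine ⟨c, fun u t x m a ha hE => ?_⟩
  have hfin : {t | Edge U S m a u x t}.Finite :=
    Set.finite_of_encard_le_coe (encard_edge_le m a u x)
  obtain ⟨i, hi, hi'⟩ := exists_two_pow_le_encard hfin ⟨t, hE⟩
  have hsub : {x' | S t x' ∧ Rich U S m a i u x'} ⊆ {x' | Rich U S m a i u x'} := fun _ h => h.2
  have hfin' : {x' | S t x' ∧ Rich U S m a i u x'}.Finite :=
    (Set.finite_of_encard_le_coe (encard_rich_le m a i u)).subset hsub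
  have hx : x ∈ {x' | S t x' ∧ Rich U S m a i u x'} := ⟨hE.1.1.2, hi⟩
  obtain ⟨k, hk, hk'⟩ := exists_two_pow_le_encard hfin' ⟨x, hx⟩
  have him := le_of_two_pow_le_encard hi (encard_edge_le m a u x)
  refine ⟨i, k, hi, hi', him, le_of_two_pow_le_encard hk
    ((Set.encard_le_encard hsub).trans (encard_rich_le m a i u)), hk, fun M hm hM => ?_⟩
  have key := hc [m, a, i] (ePair t u) x (k + 1) M ⟨(t, u), rfl, hx⟩
    ((Set.encard_le_encard (by
      rintro x' ⟨⟨t', u'⟩, h, h'⟩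
      obtain ⟨rfl, rfl⟩ := ePair_inj h
      exact h')).trans hk')
    (by
      simp only [List.mem_cons, List.not_mem_nil, or_false, forall_eq_or_imp, forall_eq]
      omega)
  rw [ha] at key
  simpa using key

/-- The degree of `x` bounds the cost of describing first the value of `f` and then the
rectangle, given `x`. -/
theorem IsUniversal.KC_add_KC_le (hU : IsUniversal U)
    (hS : SemiDec fun p : List Bool × List Bool => S p.1 p.2)
    {f : List Bool → List Bool → List Bool} (hf : Computable₂ f) :
    ∃ c : ℕ, ∀ u t x z m a i M, Edge U S m a u x t → ValueOn f t z →
      (∀ t z z', InFst u t → ValueOn f t z → ValueOn f t z' → z = z') →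
      {t | Edge U S m a u x t}.encard ≤ (2 ^ (i + 1) : ℕ) → m ≤ M → a ≤ M → i + 1 ≤ M →
      KC U z (ePair x u) + KC U t (ePair x (ePair z u)) ≤ i + 2 + 5 * (4 * M.size + 4) + c := by
  obtain ⟨c, hc⟩ := hU.KC_le_of_encard_le
    (R := fun v z => ∃ p : List Bool × List Bool, v.2 = ePair p.1 p.2 ∧
      ((2 ^ v.1.getD 2 0 : ℕ) : ℕ∞) ≤
        {t | Edge U S (v.1.getD 0 0) (v.1.getD 1 0) p.2 p.1 t ∧ ValueOn f t z}.encard)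
    (SemiDec.ex (SemiDec.and (SemiDec.eq (by fun_prop) (by fun_prop)) (SemiDec.le_encard
      (R := fun (v : ((List ℕ × List Bool) × List Bool) × List Bool × List Bool) t =>
        Edge U S (v.1.1.1.getD 0 0) (v.1.1.1.getD 1 0) v.2.2 v.2.1 t ∧ ValueOn f t v.1.2)
      (SemiDec.and (hU.semiDec_edge hS (by fun_prop) (by fun_prop) (by fun_prop) (by fun_prop)
        (by fun_prop)) (semiDec_valueOn hf (by fun_prop) (by fun_prop))) (by fun_prop))))
  obtain ⟨c', hc'⟩ := hU.KC_le_of_encard_le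
    (R := fun v t => ∃ p : List Bool × List Bool × List Bool,
      v.2 = ePair p.1 (ePair p.2.1 p.2.2) ∧
      Edge U S (v.1.getD 0 0) (v.1.getD 1 0) p.2.2 p.1 t ∧ ValueOn f t p.2.1)
    (SemiDec.ex (SemiDec.and (SemiDec.eq (by fun_prop) (by fun_prop))
      (SemiDec.and (hU.semiDec_edge hS (by fun_prop) (by fun_prop) (by fun_prop) (by fun_prop)
        (by fun_prop)) (semiDec_valueOn hf (by fun_prop) (by fun_prop)))))
  refine ⟨c + c', fun u t x z m a i M hE hz hfun hi hm ha hiM => ?_⟩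
  have hfinE : {t | Edge U S m a u x t}.Finite := Set.finite_of_encard_le_coe hi
  have hfin : {t | Edge U S m a u x t ∧ ValueOn f t z}.Finite := hfinE.subset fun _ h => h.1
  obtain ⟨l, hl, hl'⟩ := exists_two_pow_le_encard hfin ⟨t, hE, hz⟩
  have hli : l ≤ i + 1 :=
    le_of_two_pow_le_encard hl ((Set.encard_le_encard fun _ h => h.1).trans hi)
  have hvals := encard_mul_le_encard_mul (fun z t => ValueOn f t z)
    (s := {z | ((2 ^ l : ℕ) : ℕ∞) ≤ {t | Edge U S m a u x t ∧ ValueOn f t z}.encard})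
    hfinE (2 ^ l) 1 (fun z hz => hz) (fun t ht => by
      rw [Nat.cast_one, Set.encard_le_one_iff]
      exact fun z z' h h' => hfun t z z' ht.1.1.1 h.2 h'.2)
  have hvals' : {z | ((2 ^ l : ℕ) : ℕ∞) ≤
      {t | Edge U S m a u x t ∧ ValueOn f t z}.encard}.encard ≤ (2 ^ (i + 1 - l) : ℕ) := by
    refine le_of_mul_two_pow_le l (hvals.trans ?_)
    rw [Nat.cast_one, mul_one, ← Nat.cast_mul, ← pow_add, Nat.sub_add_cancel hli]
    exact hi
  have key := hc [m, a, l] (ePair x u) z (i + 1 - l) M ⟨(x, u), rfl, hl⟩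
    ((Set.encard_le_encard (by
      rintro z' ⟨⟨x', u'⟩, h, h'⟩
      obtain ⟨rfl, rfl⟩ := ePair_inj h
      exact h')).trans hvals')
    (by
      simp only [List.mem_cons, List.not_mem_nil, or_false, forall_eq_or_imp, forall_eq]
      omega)
  have key' := hc' [m, a] (ePair x (ePair z u)) t (l + 1) M ⟨(x, z, u), rfl, hE, hz⟩
    ((Set.encard_le_encard (by
      rintro t' ⟨⟨x', z', u'⟩, h, h'⟩
      obtain ⟨rfl, h⟩ := ePair_inj h
      obtain ⟨rfl, rfl⟩ := ePair_inj h
      exact h')).trans hl')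
    (by
      simp only [List.mem_cons, List.not_mem_nil, or_false, forall_eq_or_imp, forall_eq]
      omega)
  simp only [List.length_cons, List.length_nil] at key key'
  omega

/-- Few thin rectangles have many rich rows and many rich columns. -/
theorem encard_thin_mul_le (m a i m' b j k l r : ℕ) (u : List Bool) :
    {t | InFst u t ∧ Thin u t (2 ^ r) ∧
      ((2 ^ k : ℕ) : ℕ∞) ≤ {x | InFst t x ∧ Rich U InFst m a i u x}.encard ∧
      ((2 ^ l : ℕ) : ℕ∞) ≤ {y | InSnd t y ∧ Rich U InSnd m' b j u y}.encard}.encard *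
      (2 ^ (k + l + i + j) : ℕ) ≤ (2 ^ (m + a + 2 + (m' + b + 2) + r) : ℕ) := by
  set X := {x | Rich U InFst m a i u x}
  set Y := {y | Rich U InSnd m' b j u y}
  set T := {t | InFst u t ∧ Thin u t (2 ^ r) ∧ ((2 ^ k : ℕ) : ℕ∞) ≤ {x | InFst t x ∧ x ∈ X}.encard ∧
    ((2 ^ l : ℕ) : ℕ∞) ≤ {y | InSnd t y ∧ y ∈ Y}.encard}
  have hX : X.Finite := Set.finite_of_encard_le_coe (encard_rich_le m a i u)
  have hY : Y.Finite := Set.finite_of_encard_le_coe (encard_rich_le m' b j u)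
  have h := encard_mul_le_encard_mul
    (fun t (p : List Bool × List Bool) => InFst t p.1 ∧ InSnd t p.2) (s := T) (hX.prod hY) (2 ^ k * 2 ^ l) (2 ^ r) (fun t ht => ?_) fun p hp => ?_
  · calc T.encard * (2 ^ (k + l + i + j) : ℕ)
        = T.encard * (2 ^ k * 2 ^ l : ℕ) * ((2 ^ i : ℕ) * (2 ^ j : ℕ)) := by
          rw [mul_assoc]; congr 1; exact_mod_cast (by ring)
      _ ≤ (X ×ˢ Y).encard * (2 ^ r : ℕ) * ((2 ^ i : ℕ) * (2 ^ j : ℕ)) := by gcongr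
      _ = X.encard * (2 ^ i : ℕ) * (Y.encard * (2 ^ j : ℕ)) * (2 ^ r : ℕ) := by
          rw [Set.encard_prod]; ring
      _ ≤ (2 ^ (m + a + 2) : ℕ) * (2 ^ (m' + b + 2) : ℕ) * (2 ^ r : ℕ) := by
          gcongr
          · exact encard_rich_mul_le m a i u
          · exact encard_rich_mul_le m' b j u
      _ = _ := by exact_mod_cast (by ring)
  · rw [Nat.cast_mul]
    refine (mul_le_mul' ht.2.2.1 ht.2.2.2).trans ?_
    rw [← Set.encard_prod]
    exact Set.encard_le_encard fun p hp => ⟨⟨hp.1.2, hp.2.2⟩, hp.1.1, hp.2.1⟩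
  · rcases Set.eq_empty_or_nonempty {t | t ∈ T ∧ InFst t p.1 ∧ InSnd t p.2} with he | ⟨t₀, h₀⟩
    · rw [he]; simp
    obtain ⟨⟨-, ⟨⟨⟨Q, v⟩, τ⟩, ⟨rfl, rfl⟩, hthin⟩, -⟩, hx, hy⟩ := h₀
    obtain ⟨M, hM, hM'⟩ := hthin p.1 (inFst_ePair.1 hx) p.2 (inSnd_ePair.1 hy)
    have hsub : {t | t ∈ T ∧ InFst t p.1 ∧ InSnd t p.2} ⊆ encSides '' {R | R ∈ M} := by
      rintro t ⟨⟨ht, -⟩, hx, hy⟩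
      obtain ⟨R, hR, rfl⟩ := List.mem_map.1 (inFst_ePair.1 ht)
      refine ⟨R, ?_, rfl⟩
      by_contra hRM
      exact hM' R hR ⟨inFst_ePair.1 hx, inSnd_ePair.1 hy, hRM⟩
    refine (Set.encard_le_encard hsub).trans ((Set.encard_image_le _ _).trans ?_)
    classical
    rw [show {R | R ∈ M} = (M.toFinset : Set _) by ext; simp, Set.encard_coe_eq_coe_finsetCard]
    exact_mod_cast (List.toFinset_card_le M).trans hM

end Bounds

/-- A thin rectangle with many rich rows and many rich columns has a short description. -/
theorem IsUniversal.KC_thin_le {U : Machine} (hU : IsUniversal U) :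
    ∃ c : ℕ, ∀ u t m a i b j k l r M, InFst u t → Thin u t (2 ^ r) →
      ((2 ^ k : ℕ) : ℕ∞) ≤ {x | InFst t x ∧ Rich U InFst m a i u x}.encard →
      ((2 ^ l : ℕ) : ℕ∞) ≤ {y | InSnd t y ∧ Rich U InSnd m b j u y}.encard →
      (∀ p ∈ [m, a, i, b, j, k, l, r], p ≤ M) →
      KC U t u + (k + l + i + j) ≤ m + a + 2 + (m + b + 2) + r + 8 * (4 * M.size + 4) + c := by
  obtain ⟨c, hc⟩ := hU.KC_le_of_encard_le
    (R := fun v t => InFst v.2 t ∧ Thin v.2 t (2 ^ v.1.getD 7 0) ∧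
      ((2 ^ v.1.getD 5 0 : ℕ) : ℕ∞) ≤ {x | InFst t x ∧
        Rich U InFst (v.1.getD 0 0) (v.1.getD 1 0) (v.1.getD 2 0) v.2 x}.encard ∧
      ((2 ^ v.1.getD 6 0 : ℕ) : ℕ∞) ≤ {y | InSnd t y ∧
        Rich U InSnd (v.1.getD 0 0) (v.1.getD 3 0) (v.1.getD 4 0) v.2 y}.encard)
    (SemiDec.and (semiDec_inFst (by fun_prop) (by fun_prop))
      (SemiDec.and (semiDec_thin (by fun_prop) (by fun_prop) (by fun_prop))
        (SemiDec.and
          (SemiDec.le_encard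
            (R := fun (v : (List ℕ × List Bool) × List Bool) x => InFst v.2 x ∧
              Rich U InFst (v.1.1.getD 0 0) (v.1.1.getD 1 0) (v.1.1.getD 2 0) v.1.2 x)
            (SemiDec.and (semiDec_inFst (by fun_prop) (by fun_prop))
              (hU.semiDec_rich (semiDec_inFst (by fun_prop) (by fun_prop)) (by fun_prop)
                (by fun_prop) (by fun_prop) (by fun_prop) (by fun_prop))) (by fun_prop))
          (SemiDec.le_encard
            (R := fun (v : (List ℕ × List Bool) × List Bool) y => InSnd v.2 y ∧
              Rich U InSnd (v.1.1.getD 0 0) (v.1.1.getD 3 0) (v.1.1.getD 4 0) v.1.2 y)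
            (SemiDec.and (semiDec_inSnd (by fun_prop) (by fun_prop))
              (hU.semiDec_rich (semiDec_inSnd (by fun_prop) (by fun_prop)) (by fun_prop)
                (by fun_prop) (by fun_prop) (by fun_prop) (by fun_prop))) (by fun_prop)))))
  refine ⟨c, fun u t m a i b j k l r M ht hthin hk hl hM => ?_⟩
  have hT := encard_thin_mul_le (U := U) m a i m b j k l r u
  set T := {t | InFst u t ∧ Thin u t (2 ^ r) ∧
    ((2 ^ k : ℕ) : ℕ∞) ≤ {x | InFst t x ∧ Rich U InFst m a i u x}.encard ∧
    ((2 ^ l : ℕ) : ℕ∞) ≤ {y | InSnd t y ∧ Rich U InSnd m b j u y}.encard}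
  have htT : t ∈ T := ⟨ht, hthin, hk, hl⟩
  have hle : k + l + i + j ≤ m + a + 2 + (m + b + 2) + r := by
    refine (Nat.pow_le_pow_iff_right one_lt_two).1 ?_
    have h1 : 1 ≤ T.encard := Set.one_le_encard_iff_nonempty.2 ⟨t, htT⟩
    exact_mod_cast (le_mul_of_one_le_left' h1).trans hT
  have hcard : T.encard ≤ (2 ^ (m + a + 2 + (m + b + 2) + r - (k + l + i + j)) : ℕ) := by
    refine le_of_mul_two_pow_le (k + l + i + j) (hT.trans_eq ?_)
    rw [← Nat.cast_mul, ← pow_add, Nat.sub_add_cancel hle]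
  have key := hc [m, a, i, b, j, k, l, r] u t _ M htT hcard hM
  simp only [List.length_cons, List.length_nil] at key
  omega

theorem mem_allBV {n : ℕ} {x : List Bool} : x ∈ allBV n ↔ x.length = n := by
  induction n generalizing x with
  | zero => simp [allBV]
  | succ n ih =>
    cases x with
    | nil => simp [allBV]
    | cons b x => cases b <;> simp [allBV, ih]

theorem length_allBV (n : ℕ) : (allBV n).length = 2 ^ n := by
  induction n with
  | zero => rfl
  | succ n ih => simp [allBV, List.length_flatMap, ih, pow_succ]

section Protocol

variable {n₁ n₂ : ℕ} {P : Protocol n₁ n₂} {R : Rect} {x y t : List Bool}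

theorem inFst_encRect : InFst (encRect R) x ↔ x ∈ R.rows := inFst_ePair

theorem inSnd_encRect : InSnd (encRect R) y ↔ y ∈ R.cols := inSnd_ePair

theorem inFst_encProt : InFst (encProt P) t ↔ ∃ R ∈ P.rects, encRect R = t :=
  inFst_ePair.trans List.mem_map

theorem cellThick_le_rectThick (hx : x ∈ R.rows) (hy : y ∈ R.cols) :
    cellThick P x y ≤ rectThick P R := by
  have key : ∀ (l : List ℕ) (n : ℕ), n ∈ l → n ≤ l.foldr max 0 := by
    intro l n hn
    induction l with
    | nil => simp at hn
    | cons a l ih =>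
      rcases List.mem_cons.1 hn with rfl | h
      · exact le_max_left _ _
      · exact (ih h).trans (le_max_right _ _)
  exact key _ _ (List.mem_flatMap.2 ⟨x, hx, List.mem_map.2 ⟨y, hy, rfl⟩⟩)

theorem one_le_rectThick (hx : x.length = n₁) (hy : y.length = n₂) :
    1 ≤ rectThick P (P.trans x y) := by
  have hrow := P.trans_row x y hx hy
  have hcol := P.trans_col x y hx hy
  refine le_trans ?_ (cellThick_le_rectThick hrow hcol)
  exact List.countP_pos_iff.2 ⟨_, P.trans_mem x y hx hy, by simp [hrow, hcol]⟩

theorem thin_encProt {N : ℕ} (hN : rectThick P R ≤ N) : Thin (encProt P) (encRect R) N := by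
  refine ⟨((P.rects.map fun R => (R.rows, R.cols),
    eList ((allBV n₁).flatMap fun x => (allBV n₂).map fun y => encRect (P.trans x y))),
    (R.rows, R.cols)), ⟨?_, rfl⟩, fun x hx y hy =>
    ⟨(P.rects.filter fun R => decide (x ∈ R.rows ∧ y ∈ R.cols)).map fun R => (R.rows, R.cols),
      ?_, ?_⟩⟩
  · rw [List.map_map]
    rfl
  · rw [List.length_map, ← List.countP_eq_length_filter]
    exact (cellThick_le_rectThick hx hy).trans hN
  · intro Q hQ
    obtain ⟨R', hR', rfl⟩ := List.mem_map.1 hQ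
    rintro ⟨h1, h2, h3⟩
    exact h3 (List.mem_map.2 ⟨R', List.mem_filter.2 ⟨hR', by simpa using ⟨h1, h2⟩⟩, rfl⟩)

theorem IsUniversal.KC_trans_le {U : Machine} (hU : IsUniversal U) :
    ∃ c : ℕ, ∀ n₁ n₂ (P : Protocol n₁ n₂) x y, x.length = n₁ → y.length = n₂ →
      KC U (encRect (P.trans x y)) (encProt P) ≤ n₁ + n₂ + c := by
  obtain ⟨c, hc⟩ := hU.KC_le_of_encard_le (R := fun v t => InSnd v.2 t)
    (semiDec_inSnd (by fun_prop) (by fun_prop))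
  refine ⟨c, fun n₁ n₂ P x y hx hy => ?_⟩
  set L := (allBV n₁).flatMap fun x => (allBV n₂).map fun y => encRect (P.trans x y) with hL
  have hlen : L.length = 2 ^ (n₁ + n₂) := by
    simp [hL, List.length_flatMap, length_allBV, pow_add]
  have hmem : encRect (P.trans x y) ∈ L :=
    List.mem_flatMap.2 ⟨x, mem_allBV.2 hx, List.mem_map.2 ⟨y, mem_allBV.2 hy, rfl⟩⟩
  have hset : {t | InSnd (encProt P) t} = (L.toFinset : Set (List Bool)) := by
    ext t
    rw [List.coe_toFinset]
    exact inSnd_ePair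
  have key := hc [] (encProt P) _ (n₁ + n₂) 0 (inSnd_ePair.2 hmem) (by
    rw [hset, Set.encard_coe_eq_coe_finsetCard, ← hlen]
    exact_mod_cast List.toFinset_card_le L) (by simp)
  simpa using key

theorem Computes.valueOn_iff {f : List Bool → List Bool → List Bool} (hP : Computes P f)
    (hR : R ∈ P.rects) (hx : x ∈ R.rows) (hy : y ∈ R.cols) {z : List Bool} :
    ValueOn f (encRect R) z ↔ z = f x y := by
  constructor
  · rintro ⟨q, ⟨h1, h2⟩, hz⟩
    rw [Part.mem_some_iff.1 hz]
    exact hP R hR _ _ _ _ (inFst_encRect.1 h1) (inSnd_encRect.1 h2) hx hy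
  · rintro rfl
    exact ⟨(x, y), ⟨inFst_encRect.2 hx, inSnd_encRect.2 hy⟩, Part.mem_some _⟩

theorem Computes.valueOn_unique {f : List Bool → List Bool → List Bool} (hP : Computes P f)
    {z z' : List Bool} (ht : InFst (encProt P) t) (hz : ValueOn f t z) (hz' : ValueOn f t z') :
    z = z' := by
  obtain ⟨R, hR, rfl⟩ := inFst_encProt.1 ht
  obtain ⟨q, ⟨h1, h2⟩, -⟩ := id hz
  have h := @Computes.valueOn_iff _ _ _ _ _ _ f hP hR (inFst_encRect.1 h1) (inSnd_encRect.1 h2)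
  rw [h.1 hz, h.1 hz']

end Protocol

theorem IsUniversal.sum_KC_le {U : Machine} (hU : IsUniversal U)
    {f : List Bool → List Bool → List Bool} (hf : Computable₂ f) :
    ∃ c : ℕ, ∀ n₁ n₂ : ℕ, ∀ P : Protocol n₁ n₂, Computes P f →
      ∀ x y : List Bool, x.length = n₁ → y.length = n₂ →
      KC U (f x y) (ePair x (encProt P)) + KC U (f x y) (ePair y (encProt P))
        + KC U (encRect (P.trans x y)) (ePair x (ePair (f x y) (encProt P)))
        + KC U (encRect (P.trans x y)) (ePair y (ePair (f x y) (encProt P))) ≤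
      KC U (encRect (P.trans x y)) (encProt P) + Nat.clog 2 (rectThick P (P.trans x y))
        + 96 * (c * (max n₁ n₂ + 1)).size + c := by
  have hS₁ : SemiDec fun p : List Bool × List Bool => InFst p.1 p.2 :=
    semiDec_inFst (by fun_prop) (by fun_prop)
  have hS₂ : SemiDec fun p : List Bool × List Bool => InSnd p.1 p.2 :=
    semiDec_inSnd (by fun_prop) (by fun_prop)
  obtain ⟨c₀, h₀⟩ := hU.KC_trans_le
  obtain ⟨c₁, h₁⟩ := hU.KC_le_length
  obtain ⟨c₂, h₂⟩ := hU.exists_degree hS₁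
  obtain ⟨c₃, h₃⟩ := hU.exists_degree hS₂
  obtain ⟨c₄, h₄⟩ := hU.KC_add_KC_le hS₁ hf
  obtain ⟨c₅, h₅⟩ := hU.KC_add_KC_le hS₂ hf
  obtain ⟨c₆, h₆⟩ := hU.KC_thin_le
  refine ⟨c₀ + c₁ + c₂ + c₃ + c₄ + c₅ + c₆ + 110, fun n₁ n₂ P hP x y hx hy => ?_⟩
  have hR := P.trans_mem x y hx hy
  have hrow := P.trans_row x y hx hy
  have hcol := P.trans_col x y hx hy
  set z := f x y
  set u := encProt P
  set t := encRect (P.trans x y)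
  set r := Nat.clog 2 (rectThick P (P.trans x y))
  obtain ⟨m, hm⟩ : ∃ m, KC U t u = m := ⟨_, rfl⟩
  obtain ⟨a, ha⟩ : ∃ a, KC U x (ePair t u) = a := ⟨_, rfl⟩
  obtain ⟨b, hb⟩ : ∃ b, KC U y (ePair t u) = b := ⟨_, rfl⟩
  have hut : InFst u t := inFst_encProt.2 ⟨_, hR, rfl⟩
  have hEx : Edge U InFst m a u x t :=
    ⟨⟨⟨hut, inFst_encRect.2 hrow⟩, hm ▸ hU.describable t u⟩, ha ▸ hU.describable x _⟩
  have hEy : Edge U InSnd m b u y t :=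
    ⟨⟨⟨hut, inSnd_encRect.2 hcol⟩, hm ▸ hU.describable t u⟩, hb ▸ hU.describable y _⟩
  have hz : ValueOn f t z := (hP.valueOn_iff hR hrow hcol).2 rfl
  have hthin : Thin u t (2 ^ r) := thin_encProt (Nat.le_pow_clog one_lt_two _)
  have hm' : m ≤ n₁ + n₂ + c₀ := hm ▸ h₀ n₁ n₂ P x y hx hy
  have ha' : a ≤ n₁ + c₁ := ha ▸ hx ▸ h₁ x _
  have hb' : b ≤ n₂ + c₁ := hb ▸ hy ▸ h₁ y _
  obtain ⟨i, k, -, hi, him, hkm, hk, hak⟩ := h₂ u t x m a ha hEx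
  obtain ⟨j, l, -, hj, hjm, hlm, hl, hbl⟩ := h₃ u t y m b hb hEy
  have hn₁ : n₁ ≤ max n₁ n₂ := le_max_left _ _
  have hn₂ : n₂ ≤ max n₁ n₂ := le_max_right _ _
  set n := max n₁ n₂
  obtain ⟨C, hC⟩ : ∃ C, c₀ + c₁ + c₂ + c₃ + c₄ + c₅ + c₆ + 110 = C := ⟨_, rfl⟩
  rw [hC]
  obtain ⟨M, hM⟩ : ∃ M, C * (n + 1) = M := ⟨_, rfl⟩
  have hM' : 3 * n + c₀ + c₁ + 5 ≤ M := by
    rw [← hM, Nat.mul_add, mul_one]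
    have : 3 * n ≤ C * n := Nat.mul_le_mul_right n (by omega)
    omega
  have hxsum := h₄ u t x z m a i M hEx hz (fun _ _ _ => hP.valueOn_unique) hi (by omega)
    (by omega) (by omega)
  have hysum := h₅ u t y z m b j M hEy hz (fun _ _ _ => hP.valueOn_unique) hj (by omega)
    (by omega) (by omega)
  have hak := hak M (by omega) (by omega)
  have hbl := hbl M (by omega) (by omega)
  have hij : i + j ≤ m + r + 6 + 14 * (4 * M.size + 4) + c₂ + c₃ + c₆ := by
    rcases le_or_gt r (m + 3) with hr | hr
    · have := h₆ u t m a i b j k l r M hut hthin hk hl (by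
        simp only [List.mem_cons, List.not_mem_nil, or_false, forall_eq_or_imp, forall_eq]
        omega)
      omega
    · omega
  rw [hM, hm]
  omega

theorem size_mul_succ_le (c n : ℕ) : ((c * (n + 1)).size : ℝ) ≤ c + 2 + Real.logb 2 n := by
  have h : (c * (n + 1)).size ≤ c + 2 + Nat.log 2 n := by
    rw [Nat.size_le, add_assoc, pow_add, add_comm 2]
    refine Nat.mul_lt_mul_of_le_of_lt Nat.lt_two_pow_self.le ?_ (by positivity)
    have := Nat.lt_pow_succ_log_self one_lt_two n
    rw [pow_succ] at this ⊢
    rw [pow_succ]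
    omega
  calc ((c * (n + 1)).size : ℝ) ≤ (c + 2 + Nat.log 2 n : ℕ) := by exact_mod_cast h
    _ ≤ c + 2 + Real.logb 2 n := by
      push_cast
      gcongr
      exact_mod_cast Real.natLog_le_logb n 2

theorem clog_two_le_logb_add_one {n : ℕ} (hn : 1 ≤ n) :
    (Nat.clog 2 n : ℝ) ≤ Real.logb 2 n + 1 := by
  have h := Real.natCeil_logb_natCast 2 n
  rw [← h]
  exact (Nat.ceil_lt_add_one (Real.logb_nonneg (by norm_num) (by exact_mod_cast hn))).le

/-- Lower bound on the complexity of the transcript of a protocol computing a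
computable function `f`. -/
theorem stmt6 (U : Machine) (hU : IsUniversal U)
    (f : List Bool → List Bool → List Bool) (hf : Computable₂ f) :
    ∃ d : ℝ, ∀ n₁ n₂ : ℕ, ∀ P : Protocol n₁ n₂, Computes P f →
      ∀ x y : List Bool, x.length = n₁ → y.length = n₂ →
      (KC U (encRect (P.trans x y)) (encProt P) : ℝ) ≥
        (KC U (f x y) (ePair x (encProt P)) : ℝ)
        + KC U (f x y) (ePair y (encProt P))
        + KC U (encRect (P.trans x y)) (ePair x (ePair (f x y) (encProt P)))
        + KC U (encRect (P.trans x y)) (ePair y (ePair (f x y) (encProt P)))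
        - Real.logb 2 (rectThick P (P.trans x y))
        - d * Real.logb 2 (max n₁ n₂) - d := by
  obtain ⟨c, hc⟩ := hU.sum_KC_le hf
  refine ⟨97 * c + 196, fun n₁ n₂ P hP x y hx hy => ?_⟩
  have h := hc n₁ n₂ P hP x y hx hy
  have hsum : (KC U (f x y) (ePair x (encProt P)) : ℝ) + KC U (f x y) (ePair y (encProt P))
      + KC U (encRect (P.trans x y)) (ePair x (ePair (f x y) (encProt P)))
      + KC U (encRect (P.trans x y)) (ePair y (ePair (f x y) (encProt P))) ≤
      KC U (encRect (P.trans x y)) (encProt P) + Nat.clog 2 (rectThick P (P.trans x y))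
        + 96 * (c * (max n₁ n₂ + 1)).size + c := by exact_mod_cast h
  have hclog := clog_two_le_logb_add_one (one_le_rectThick (P := P) hx hy)
  have hsize := size_mul_succ_le c (max n₁ n₂)
  rw [Nat.cast_max] at hsize
  have hlog : 0 ≤ Real.logb 2 (max (n₁ : ℝ) n₂) := by
    rw [← Nat.cast_max]
    exact (Nat.cast_nonneg _).trans (Real.natLog_le_logb _ 2)
  have hc0 : 0 ≤ (97 * c + 100 : ℝ) * Real.logb 2 (max (n₁ : ℝ) n₂) := by positivity
  linarith
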